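/- arXiv:math/9806124 — 8 statements merged into one kernel-verified Lean document; each statement's English description precedes it below -/
import Mathlib

section
/- Exactly one of the following five cases holds for the field K: (A) ε_2 ∈ K and ε_n ∈ K for every natural number n; (B) ε_2 ∈ K and there exists a unique natural number m ≥ 2 such that ε_m ∈ K and ε_{m+1} ∉ K; (C) ε_2 ∉ K and ε_n + ε_n^{−1} ∈ K for every natural number n; (D) ε_2 ∉ K and there exists a unique natural number m ≥ 2 such that ε_m + ε_m^{−1} ∈ K, ε_{m+1} + ε_{m+1}^{−1} ∉ K and ε_{m+1} − ε_{m+1}^{−1} ∉ K; (E) ε_2 ∉ K and there exists a unique natural number m ≥ 3 such that ε_m − ε_m^{−1} ∈ K. -/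
noncomputable section

/-- `x ∈ K̄` lies in (the image of) the base field `K`. -/
def InK (K : Type*) [Field K] (x : AlgebraicClosure K) : Prop :=
  x ∈ Set.range (algebraMap K (AlgebraicClosure K))

/-- Type A: `ε₂ ∈ K` and `εₙ ∈ K` for every `n`. -/
def TypeA (K : Type*) [Field K] (ε : ℕ → AlgebraicClosure K) : Prop :=
  InK K (ε 2) ∧ ∀ n : ℕ, InK K (ε n)

/-- Type B: `ε₂ ∈ K` and there is a unique `m ≥ 2` with `ε_m ∈ K`, `ε_{m+1} ∉ K`. -/
def TypeB (K : Type*) [Field K] (ε : ℕ → AlgebraicClosure K) : Prop :=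
  InK K (ε 2) ∧ ∃! m : ℕ, 2 ≤ m ∧ InK K (ε m) ∧ ¬InK K (ε (m + 1))

/-- Type C: `ε₂ ∉ K` and `εₙ + εₙ⁻¹ ∈ K` for every `n`. -/
def TypeC (K : Type*) [Field K] (ε : ℕ → AlgebraicClosure K) : Prop :=
  ¬InK K (ε 2) ∧ ∀ n : ℕ, InK K (ε n + (ε n)⁻¹)

/-- Type D: `ε₂ ∉ K` and there is a unique `m ≥ 2` with `ε_m + ε_m⁻¹ ∈ K`,
`ε_{m+1} + ε_{m+1}⁻¹ ∉ K` and `ε_{m+1} - ε_{m+1}⁻¹ ∉ K`. -/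
def TypeD (K : Type*) [Field K] (ε : ℕ → AlgebraicClosure K) : Prop :=
  ¬InK K (ε 2) ∧ ∃! m : ℕ, 2 ≤ m ∧ InK K (ε m + (ε m)⁻¹) ∧
    ¬InK K (ε (m + 1) + (ε (m + 1))⁻¹) ∧ ¬InK K (ε (m + 1) - (ε (m + 1))⁻¹)

/-- Type E: `ε₂ ∉ K` and there is a unique `m ≥ 3` with `ε_m - ε_m⁻¹ ∈ K`. -/
def TypeE (K : Type*) [Field K] (ε : ℕ → AlgebraicClosure K) : Prop :=
  ¬InK K (ε 2) ∧ ∃! m : ℕ, 3 ≤ m ∧ InK K (ε m - (ε m)⁻¹)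

/-- Type B with constant `m`. -/
def TypeBc (K : Type*) [Field K] (ε : ℕ → AlgebraicClosure K) (m : ℕ) : Prop :=
  InK K (ε 2) ∧ 2 ≤ m ∧ InK K (ε m) ∧ ¬InK K (ε (m + 1))

/-- Type D with constant `m`. -/
def TypeDc (K : Type*) [Field K] (ε : ℕ → AlgebraicClosure K) (m : ℕ) : Prop :=
  ¬InK K (ε 2) ∧ 2 ≤ m ∧ InK K (ε m + (ε m)⁻¹) ∧
    ¬InK K (ε (m + 1) + (ε (m + 1))⁻¹) ∧ ¬InK K (ε (m + 1) - (ε (m + 1))⁻¹)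

/-- Type E with constant `m`. -/
def TypeEc (K : Type*) [Field K] (ε : ℕ → AlgebraicClosure K) (m : ℕ) : Prop :=
  ¬InK K (ε 2) ∧ 3 ≤ m ∧ InK K (ε m - (ε m)⁻¹)

/-- `a ∈ K_s = K* ∩ (K(ε₂)*)^{2^s}`: `a = α^{2^s}` for some `α ∈ K(ε₂)*`. -/
def MemKs (K : Type*) [Field K] (ε : ℕ → AlgebraicClosure K) (s : ℕ) (a : K) : Prop :=
  ∃ α : AlgebraicClosure K, α ∈ IntermediateField.adjoin K {ε 2} ∧ α ≠ 0 ∧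
    algebraMap K (AlgebraicClosure K) a = α ^ 2 ^ s

/-- A minimal idempotent of a commutative ring: a nonzero idempotent which is not
the sum of two nonzero orthogonal idempotents. -/
def IsMinIdem {A : Type*} [CommRing A] (e : A) : Prop :=
  e ≠ 0 ∧ e * e = e ∧
    ¬∃ e₁ e₂ : A, e₁ ≠ 0 ∧ e₂ ≠ 0 ∧ e₁ * e₁ = e₁ ∧ e₂ * e₂ = e₂ ∧
      e₁ * e₂ = 0 ∧ e = e₁ + e₂

/-- A predicate on `ℕ` inherited by predecessors which holds at `a` but not everywhere
cuts out an initial segment. -/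
lemma exists_forall_iff_le {Q : ℕ → Prop} (hQ : ∀ n, Q (n + 1) → Q n) {a : ℕ} (ha : Q a)
    (hn : ¬∀ n, Q n) : ∃ m, a ≤ m ∧ ∀ k, Q k ↔ k ≤ m := by
  classical
  have hanti : Antitone Q := antitone_nat_of_succ_le hQ
  push Not at hn
  have hspec := Nat.find_spec hn
  have hlt : a < Nat.find hn := by
    by_contra! h
    exact hspec (hanti h ha)
  refine ⟨Nat.find hn - 1, by omega, fun k => ⟨fun hk => ?_, fun hk => ?_⟩⟩
  · by_contra! h
    exact hspec (hanti (by omega) hk)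
  · exact not_not.mp (Nat.find_min hn (by omega))

lemma inK_iff_mem_bot {K : Type*} [Field K] {x : AlgebraicClosure K} :
    InK K x ↔ x ∈ (⊥ : IntermediateField K (AlgebraicClosure K)) :=
  IntermediateField.mem_bot.symm

section
variable {K : Type*} [Field K] {x y : AlgebraicClosure K}

lemma InK.sq (hx : InK K x) : InK K (x ^ 2) :=
  inK_iff_mem_bot.mpr (pow_mem (inK_iff_mem_bot.mp hx) 2)

lemma InK.of_add_ofNat_two (hx : InK K (x + 2)) : InK K x := by
  rw [inK_iff_mem_bot] at hx ⊢
  simpa using sub_mem hx (ofNat_mem _ 2)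

lemma InK.of_sub_ofNat_two (hx : InK K (x - 2)) : InK K x := by
  rw [inK_iff_mem_bot] at hx ⊢
  simpa using add_mem hx (ofNat_mem _ 2)

lemma InK.of_add_of_sub (h2 : (2 : K) ≠ 0) (hadd : InK K (x + y)) (hsub : InK K (x - y)) :
    InK K x := by
  have h2' : (2 : AlgebraicClosure K) ≠ 0 := by
    rwa [← map_ofNat (algebraMap K (AlgebraicClosure K)) 2, map_ne_zero]
  rw [inK_iff_mem_bot] at hadd hsub ⊢
  have h := div_mem (add_mem hadd hsub) (ofNat_mem _ 2)
  rwa [add_add_sub_cancel, ← two_mul, mul_div_cancel_left₀ _ h2'] at h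

end

/-- Exactly one of the five cases A–E holds for a field `K` of characteristic `≠ 2`. -/
theorem stmt_0 (K : Type*) [Field K] (h2 : (2 : K) ≠ 0)
    (ε : ℕ → AlgebraicClosure K)
    (hprim : ∀ n : ℕ, IsPrimitiveRoot (ε n) (2 ^ n))
    (hcomp : ∀ n : ℕ, ε (n + 1) ^ 2 = ε n) :
    (TypeA K ε ∧ ¬TypeB K ε ∧ ¬TypeC K ε ∧ ¬TypeD K ε ∧ ¬TypeE K ε) ∨
    (¬TypeA K ε ∧ TypeB K ε ∧ ¬TypeC K ε ∧ ¬TypeD K ε ∧ ¬TypeE K ε) ∨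
    (¬TypeA K ε ∧ ¬TypeB K ε ∧ TypeC K ε ∧ ¬TypeD K ε ∧ ¬TypeE K ε) ∨
    (¬TypeA K ε ∧ ¬TypeB K ε ∧ ¬TypeC K ε ∧ TypeD K ε ∧ ¬TypeE K ε) ∨
    (¬TypeA K ε ∧ ¬TypeB K ε ∧ ¬TypeC K ε ∧ ¬TypeD K ε ∧ TypeE K ε) := by
  have hne (n : ℕ) : ε n ≠ 0 := (hprim n).ne_zero (by positivity)
  have hP (n : ℕ) (h : InK K (ε (n + 1))) : InK K (ε n) := hcomp n ▸ h.sq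
  have hS (n : ℕ) (h : InK K (ε (n + 1) + (ε (n + 1))⁻¹)) : InK K (ε n + (ε n)⁻¹) := by
    refine InK.of_add_ofNat_two ?_
    convert h.sq using 1
    have := hne (n + 1)
    rw [← hcomp n]
    field_simp
    ring
  have hD (n : ℕ) (h : InK K (ε (n + 1) - (ε (n + 1))⁻¹)) : InK K (ε n + (ε n)⁻¹) := by
    refine InK.of_sub_ofNat_two ?_
    convert h.sq using 1
    have := hne (n + 1)
    rw [← hcomp n]
    field_simp
    ring
  have hPanti : Antitone fun n => InK K (ε n) := antitone_nat_of_succ_le hP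
  have hS2 : InK K (ε 2 + (ε 2)⁻¹) := by
    have h1 : ε 1 = -1 := IsPrimitiveRoot.eq_neg_one_of_two_right (by simpa using hprim 1)
    have h : ε 2 + (ε 2)⁻¹ = 0 := by
      have := hne 2
      have hsq := hcomp 1
      rw [h1] at hsq
      field_simp
      linear_combination hsq
    rw [h, inK_iff_mem_bot]
    exact zero_mem _
  unfold TypeA TypeB TypeC TypeD TypeE
  by_cases h : InK K (ε 2)
  · by_cases hall : ∀ n, InK K (ε n)
    · simp [hall]
    · obtain ⟨m, hm, hiff⟩ := exists_forall_iff_le hP h hall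
      refine Or.inr (Or.inl ⟨fun hA => hall hA.2, ⟨h, m, ?_, ?_⟩, fun hC => hC.1 h,
        fun hD => hD.1 h, fun hE => hE.1 h⟩)
      · simp [hiff, hm]
      · intro k hk
        simp only [hiff] at hk
        omega
  have hSD (n : ℕ) (hn : 2 ≤ n) (hs : InK K (ε n + (ε n)⁻¹)) : ¬InK K (ε n - (ε n)⁻¹) :=
    fun hd => h (hPanti hn (hs.of_add_of_sub h2 hd))
  by_cases hall : ∀ n, InK K (ε n + (ε n)⁻¹)
  · refine Or.inr (Or.inr (Or.inl ⟨fun hA => h hA.1, fun hB => h hB.1, ⟨h, hall⟩, ?_, ?_⟩))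
    · rintro ⟨-, m, ⟨-, -, hm, -⟩, -⟩
      exact hm (hall _)
    · rintro ⟨-, m, ⟨hm3, hm⟩, -⟩
      exact hSD m (by omega) (hall m) hm
  obtain ⟨m, hm, hiff⟩ := exists_forall_iff_le hS hS2 hall
  have hD_eq (k : ℕ) (hk : 3 ≤ k) (hd : InK K (ε k - (ε k)⁻¹)) : k = m + 1 := by
    obtain ⟨j, rfl⟩ : ∃ j, k = j + 1 := ⟨k - 1, by omega⟩
    have hj := (hiff j).mp (hD j hd)
    have hj' : ¬j + 1 ≤ m := fun hle => hSD (j + 1) (by omega) ((hiff _).mpr hle) hd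
    omega
  by_cases hd : InK K (ε (m + 1) - (ε (m + 1))⁻¹)
  · refine Or.inr (Or.inr (Or.inr (Or.inr ⟨fun hA => h hA.1, fun hB => h hB.1,
      fun hC => hall hC.2, ?_, h, m + 1, ⟨by omega, hd⟩, fun k hk => hD_eq k hk.1 hk.2⟩)))
    rintro ⟨-, k, ⟨-, hk, hk', hkd⟩, -⟩
    rw [hiff] at hk hk'
    obtain rfl : k = m := by omega
    exact hkd hd
  · refine Or.inr (Or.inr (Or.inr (Or.inl ⟨fun hA => h hA.1, fun hB => h hB.1,
      fun hC => hall hC.2, ⟨h, m, ⟨hm, (hiff m).mpr le_rfl, by simp [hiff], hd⟩, ?_⟩, ?_⟩)))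
    · rintro k ⟨-, hk, hk', -⟩
      rw [hiff] at hk hk'
      omega
    · rintro ⟨-, k, ⟨hk3, hk⟩, -⟩
      exact hd (hD_eq k hk3 hk ▸ hk)
end
end

section
/- If K is of type B with constant m, of type D with constant m, or of type E with constant m, then for every natural number l > m one has ε_{l+1} + ε_{l+1}^{−1} ∉ K and ε_{l+1} − ε_{l+1}^{−1} ∉ K. -/
noncomputable section

theorem inK_iff_mem_fieldRange {K : Type*} [Field K] {x : AlgebraicClosure K} :
    InK K x ↔ x ∈ (algebraMap K (AlgebraicClosure K)).fieldRange :=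
  Iff.rfl

section SquareRootTower

variable {L : Type*} [Field L] {F : Subfield L} {ε : ℕ → L}

theorem add_inv_mem_of_le (h0 : ∀ n, ε n ≠ 0) (hcomp : ∀ n, ε (n + 1) ^ 2 = ε n)
    {k n : ℕ} (hkn : k ≤ n) (h : ε n + (ε n)⁻¹ ∈ F) : ε k + (ε k)⁻¹ ∈ F := by
  induction n, hkn using Nat.le_induction with
  | base => exact h
  | succ n _ ih =>
    have e : ε n + (ε n)⁻¹ = (ε (n + 1) + (ε (n + 1))⁻¹) ^ 2 - 2 := by
      have := h0 (n + 1)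
      rw [← hcomp n]
      field_simp
      ring
    exact ih (e ▸ sub_mem (pow_mem h 2) (ofNat_mem F 2))

theorem add_inv_mem_of_sub_inv_mem (h0 : ∀ n, ε n ≠ 0) (hcomp : ∀ n, ε (n + 1) ^ 2 = ε n)
    {n : ℕ} (h : ε (n + 1) - (ε (n + 1))⁻¹ ∈ F) : ε n + (ε n)⁻¹ ∈ F := by
  have e : ε n + (ε n)⁻¹ = (ε (n + 1) - (ε (n + 1))⁻¹) ^ 2 + 2 := by
    have := h0 (n + 1)
    rw [← hcomp n]
    field_simp
    ring
  exact e ▸ add_mem (pow_mem h 2) (ofNat_mem F 2)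

theorem root_mem_of_le (hcomp : ∀ n, ε (n + 1) ^ 2 = ε n)
    {k n : ℕ} (hkn : k ≤ n) (h : ε n ∈ F) : ε k ∈ F := by
  induction n, hkn using Nat.le_induction with
  | base => exact h
  | succ n _ ih => exact ih (hcomp n ▸ pow_mem h 2)

theorem mem_of_add_inv_mem_of_sub_inv_mem (h2 : (2 : L) ≠ 0) {x : L}
    (hc : x + x⁻¹ ∈ F) (hs : x - x⁻¹ ∈ F) : x ∈ F := by
  have e : x = ((x + x⁻¹) + (x - x⁻¹)) / 2 := by
    rw [eq_div_iff h2]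
    ring
  exact e ▸ div_mem (add_mem hc hs) (ofNat_mem F 2)

theorem mem_succ_of_add_inv_mem (h2 : (2 : L) ≠ 0) (h0 : ∀ n, ε n ≠ 0)
    (hcomp : ∀ n, ε (n + 1) ^ 2 = ε n) {n : ℕ} (hn : ε n ≠ -1) (h : ε n ∈ F)
    (hc : ε (n + 1) + (ε (n + 1))⁻¹ ∈ F) : ε (n + 1) ∈ F := by
  have hne := h0 (n + 1)
  have hc0 : ε (n + 1) + (ε (n + 1))⁻¹ ≠ 0 := fun h => by
    field_simp at h
    exact hn (by rw [← hcomp n]; linear_combination h)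
  have e : ε (n + 1) - (ε (n + 1))⁻¹ =
      (ε n - (ε n)⁻¹) / (ε (n + 1) + (ε (n + 1))⁻¹) := by
    rw [eq_div_iff hc0, ← hcomp n]
    field_simp
    ring
  exact mem_of_add_inv_mem_of_sub_inv_mem h2 hc
    (e ▸ div_mem (sub_mem h (inv_mem h)) hc)

end SquareRootTower

/-- If `K` is of type B, D or E with constant `m`, then for every `l > m` one has
`ε_{l+1} + ε_{l+1}⁻¹ ∉ K` and `ε_{l+1} - ε_{l+1}⁻¹ ∉ K`. -/
theorem stmt_2 (K : Type*) [Field K] (h2 : (2 : K) ≠ 0)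
    (ε : ℕ → AlgebraicClosure K)
    (hprim : ∀ n : ℕ, IsPrimitiveRoot (ε n) (2 ^ n))
    (hcomp : ∀ n : ℕ, ε (n + 1) ^ 2 = ε n)
    (m : ℕ) (hBDE : TypeBc K ε m ∨ TypeDc K ε m ∨ TypeEc K ε m) :
    ∀ l : ℕ, m < l →
      ¬InK K (ε (l + 1) + (ε (l + 1))⁻¹) ∧ ¬InK K (ε (l + 1) - (ε (l + 1))⁻¹) := by
  have h2' : (2 : AlgebraicClosure K) ≠ 0 := by
    rw [← map_ofNat (algebraMap K (AlgebraicClosure K)) 2]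
    exact (map_ne_zero _).2 h2
  have h0 : ∀ n, ε n ≠ 0 := fun n => (hprim n).ne_zero (by positivity)
  simp only [TypeBc, TypeDc, TypeEc, inK_iff_mem_fieldRange] at hBDE ⊢
  intro l hl
  suffices h : ε l + (ε l)⁻¹ ∉ (algebraMap K (AlgebraicClosure K)).fieldRange from
    ⟨fun hc => h (add_inv_mem_of_le h0 hcomp l.le_succ hc),
      fun hs => h (add_inv_mem_of_sub_inv_mem h0 hcomp hs)⟩
  intro hl'
  have hc := add_inv_mem_of_le h0 hcomp hl hl'
  rcases hBDE with ⟨-, hm, hin, hout⟩ | ⟨-, -, -, hout, -⟩ | ⟨hout, hm, hs⟩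
  · refine hout (mem_succ_of_add_inv_mem h2' h0 hcomp (fun h => ?_) hin hc)
    refine (hprim m).pow_ne_one_of_pos_of_lt two_ne_zero ?_ (by rw [h]; ring)
    calc 2 < 2 ^ 2 := by norm_num
      _ ≤ 2 ^ m := Nat.pow_le_pow_right two_pos hm
  · exact hout hc
  · exact hout (root_mem_of_le hcomp (by lia)
      (mem_of_add_inv_mem_of_sub_inv_mem h2'
        (add_inv_mem_of_le h0 hcomp m.le_succ hc) hs))
end
end

section
/- Suppose K is of type C. Let α ∈ K(ε_2)*, let c = N(α) ∈ K*, and suppose α^2 = c·ε_t for some natural number t ≥ 0. Then c is a square in K*, i.e. c = c_1^2 for some c_1 ∈ K*. -/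
noncomputable section

section QuadraticExtension

variable {K L : Type*} [Field K] [Field L] [Algebra K L]

/-- If `i ^ 2 = -1`, every element of `K(i)` has the form `a + b * i`. -/
lemma exists_add_mul_of_mem_adjoin {i : L} (hi : i ^ 2 = -1) {x : L}
    (hx : x ∈ IntermediateField.adjoin K {i}) :
    ∃ a b : K, x = algebraMap K L a + algebraMap K L b * i := by
  have hint : IsIntegral K i := by
    refine ⟨Polynomial.X ^ 2 + 1, by monicity!, by simp [hi]⟩
  rw [← IntermediateField.mem_toSubalgebra,
    IntermediateField.adjoin_simple_toSubalgebra_of_isAlgebraic hint.isAlgebraic] at hx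
  induction hx using Algebra.adjoin_induction with
  | mem x hx => exact ⟨0, 1, by simp_all⟩
  | algebraMap r => exact ⟨r, 0, by simp⟩
  | add x y _ _ hx hy =>
    obtain ⟨a, b, rfl⟩ := hx
    obtain ⟨c, d, rfl⟩ := hy
    exact ⟨a + c, b + d, by simp only [map_add]; ring⟩
  | mul x y _ _ hx hy =>
    obtain ⟨a, b, rfl⟩ := hx
    obtain ⟨c, d, rfl⟩ := hy
    refine ⟨a * c - b * d, a * d + b * c, ?_⟩
    simp only [map_add, map_sub, map_mul]
    linear_combination (algebraMap K L b * algebraMap K L d) * hi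

/-- A nontrivial automorphism of `K(i)` does not fix `i`. -/
lemma map_ne_of_ne_refl {i : L} {σ : IntermediateField.adjoin K {i} ≃ₐ[K]
    IntermediateField.adjoin K {i}} (hσ : σ ≠ AlgEquiv.refl)
    {z : IntermediateField.adjoin K {i}} (hz : (z : L) = i) : σ z ≠ z := by
  intro h
  apply hσ
  obtain rfl : z = IntermediateField.AdjoinSimple.gen K i := Subtype.ext hz
  have : (σ : IntermediateField.adjoin K {i} →ₐ[K] IntermediateField.adjoin K {i}) =
      AlgHom.id K _ := by
    apply IntermediateField.adjoin_algHom_ext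
    rintro x hx
    obtain rfl : x = i := hx
    exact h
  ext x
  exact congrArg Subtype.val (DFunLike.congr_fun this x)

/-- An element of `K(i)` fixed by a nontrivial `K`-automorphism lies in `K`. -/
lemma exists_algebraMap_eq_of_map_eq {i : L} (hi : i ^ 2 = -1)
    {σ : IntermediateField.adjoin K {i} ≃ₐ[K] IntermediateField.adjoin K {i}}
    (hσ : σ ≠ AlgEquiv.refl) {x : IntermediateField.adjoin K {i}} (hx : σ x = x) :
    ∃ a : K, algebraMap K (IntermediateField.adjoin K {i}) a = x := by
  obtain ⟨a, b, hab⟩ := exists_add_mul_of_mem_adjoin hi x.2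
  set z := IntermediateField.AdjoinSimple.gen K i
  have hxz : x = algebraMap K _ a + algebraMap K _ b * z := Subtype.ext hab
  have hz := map_ne_of_ne_refl hσ (z := z) rfl
  rw [hxz, map_add, map_mul, AlgEquiv.commutes, AlgEquiv.commutes] at hx
  have hb : algebraMap K (IntermediateField.adjoin K {i}) b = 0 := by
    have h : algebraMap K (IntermediateField.adjoin K {i}) b * (σ z - z) = 0 := by
      linear_combination hx
    exact (mul_eq_zero.mp h).resolve_right (sub_ne_zero.mpr hz)
  exact ⟨a, by rw [hxz, hb]; ring⟩

end QuadraticExtension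

/-- In type C, all `2`-power roots of unity lie in `K(ε₂)`. -/
lemma TypeC.mem_adjoin {K : Type*} [Field K] {ε : ℕ → AlgebraicClosure K}
    (hprim : ∀ n : ℕ, IsPrimitiveRoot (ε n) (2 ^ n))
    (hcomp : ∀ n : ℕ, ε (n + 1) ^ 2 = ε n) (hC : TypeC K ε) (n : ℕ) :
    ε n ∈ IntermediateField.adjoin K {ε 2} := by
  have key : ∀ n : ℕ, ε (n + 2) ∈ IntermediateField.adjoin K {ε 2} := by
    intro n
    induction n with
    | zero => exact IntermediateField.mem_adjoin_simple_self K (ε 2)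
    | succ n ih =>
      have h0 : ε (n + 3) ≠ 0 := (hprim _).ne_zero (by positivity)
      obtain ⟨s, hs⟩ := hC.2 (n + 3)
      have hsum : algebraMap K _ s * ε (n + 3) = ε (n + 2) + 1 := by
        rw [hs, ← hcomp (n + 2)]
        field_simp
      have hne : ε (n + 2) + 1 ≠ 0 := by
        intro h
        have h1 : ε (n + 2) ^ 2 = 1 := by linear_combination (ε (n + 2) - 1) * h
        have h4 := (hprim (n + 2)).dvd_of_pow_eq_one 2 h1
        have := Nat.le_of_dvd (by norm_num) h4
        have : 1 ≤ 2 ^ n := Nat.one_le_two_pow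
        rw [pow_add] at *
        omega
      have hs0 : algebraMap K (AlgebraicClosure K) s ≠ 0 := by
        rintro h
        exact hne (by rw [← hsum, h, zero_mul])
      rw [show ε (n + 1 + 2) = (ε (n + 2) + 1) / algebraMap K _ s from
        (eq_div_iff hs0).mpr (by rw [mul_comm]; exact hsum)]
      exact div_mem (add_mem ih (one_mem _)) (IntermediateField.algebraMap_mem _ s)
  rw [← hcomp n, ← hcomp (n + 1)]
  exact pow_mem (pow_mem (key n) 2) 2

/-- In type C, the nontrivial automorphism of `K(ε₂)` inverts `2`-power roots of unity. -/
lemma TypeC.mul_map_eq_one {K : Type*} [Field K] {ε : ℕ → AlgebraicClosure K}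
    (hprim : ∀ n : ℕ, IsPrimitiveRoot (ε n) (2 ^ n))
    (hcomp : ∀ n : ℕ, ε (n + 1) ^ 2 = ε n) (hC : TypeC K ε)
    {σ : IntermediateField.adjoin K {ε 2} ≃ₐ[K] IntermediateField.adjoin K {ε 2}}
    (hσ : σ ≠ AlgEquiv.refl) (n : ℕ) {z : IntermediateField.adjoin K {ε 2}}
    (hz : (z : AlgebraicClosure K) = ε n) : z * σ z = 1 := by
  have key : ∀ (n : ℕ) (z : IntermediateField.adjoin K {ε 2}),
      (z : AlgebraicClosure K) = ε (n + 2) → z * σ z = 1 := by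
    intro n z hz
    have h0 : z ≠ 0 := by
      rintro rfl
      exact (hprim (n + 2)).ne_zero (by positivity) hz.symm
    obtain ⟨s, hs⟩ := hC.2 (n + 2)
    have hs' : algebraMap K (IntermediateField.adjoin K {ε 2}) s * z = z ^ 2 + 1 := by
      have : algebraMap K (IntermediateField.adjoin K {ε 2}) s = z + z⁻¹ := by
        apply Subtype.ext
        push_cast
        rw [hz]
        exact hs
      rw [this]
      field_simp
    have hmap := congrArg σ hs'
    simp only [map_mul, map_add, map_pow, map_one, AlgEquiv.commutes] at hmap
    have hne : σ z ≠ z := by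
      intro h
      have hpow : ∀ m : ℕ, ε (m + 2) ^ 2 ^ m = ε 2 := by
        intro m
        induction m with
        | zero => simp
        | succ m ih => rw [pow_succ', pow_mul, show m + 1 + 2 = m + 2 + 1 by ring, hcomp, ih]
      refine map_ne_of_ne_refl hσ (z := z ^ 2 ^ n) ?_ (by rw [map_pow, h])
      push_cast
      rw [hz, hpow]
    have h : (z - σ z) * (z * σ z - 1) = 0 := by
      linear_combination z * hmap - σ z * hs'
    exact sub_eq_zero.mp ((mul_eq_zero.mp h).resolve_left (sub_ne_zero.mpr hne.symm))
  let w : IntermediateField.adjoin K {ε 2} := ⟨ε (n + 2), hC.mem_adjoin hprim hcomp _⟩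
  have hw : w * σ w = 1 := key n w rfl
  have hzw : z = w ^ 4 := by
    apply Subtype.ext
    change (z : AlgebraicClosure K) = ε (n + 2) ^ 4
    rw [hz, ← hcomp n, ← hcomp (n + 1)]
    ring
  rw [hzw, map_pow, ← mul_pow, hw, one_pow]

/-- Lemma 2, case 1): type C.  If `α ∈ K(ε₂)*`, `c = N(α) = α·σ(α) ∈ K*` and
`α² = c·ε_t`, then `c` is a square in `K*`. -/
theorem stmt_3 (K : Type*) [Field K] (h2 : (2 : K) ≠ 0)
    (ε : ℕ → AlgebraicClosure K)
    (hprim : ∀ n : ℕ, IsPrimitiveRoot (ε n) (2 ^ n))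
    (hcomp : ∀ n : ℕ, ε (n + 1) ^ 2 = ε n)
    (hC : TypeC K ε)
    (σ : (IntermediateField.adjoin K {ε 2}) ≃ₐ[K] (IntermediateField.adjoin K {ε 2}))
    (hσ : σ ≠ AlgEquiv.refl)
    (α : IntermediateField.adjoin K {ε 2}) (hα : α ≠ 0)
    (c : K) (hc : algebraMap K (IntermediateField.adjoin K {ε 2}) c = α * σ α)
    (t : ℕ)
    (ht : (α : AlgebraicClosure K) ^ 2 = algebraMap K (AlgebraicClosure K) c * ε t) :
    ∃ c₁ : K, c₁ ≠ 0 ∧ c = c₁ ^ 2 := by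
  have hi : ε 2 ^ 2 = -1 := by
    rw [hcomp 1]
    exact IsPrimitiveRoot.eq_neg_one_of_two_right (by simpa using hprim 1)
  let z : IntermediateField.adjoin K {ε 2} := ⟨ε (t + 1), hC.mem_adjoin hprim hcomp _⟩
  have hz : z * σ z = 1 := hC.mul_map_eq_one hprim hcomp hσ (t + 1) rfl
  have ht' : α ^ 2 = algebraMap K _ c * z ^ 2 := by
    apply Subtype.ext
    change (α : AlgebraicClosure K) ^ 2 = algebraMap K _ c * ε (t + 1) ^ 2
    rw [hcomp, ht]
  have hασ : α = σ α * z ^ 2 := by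
    apply mul_left_cancel₀ hα
    linear_combination ht' + z ^ 2 * hc
  obtain ⟨b, hb⟩ := exists_algebraMap_eq_of_map_eq hi hσ (x := α * σ z) (by
    have hzz : σ z * σ (σ z) = 1 := by rw [← map_mul, hz, map_one]
    have hinv : σ (σ z) = z := by linear_combination z * hzz - σ (σ z) * hz
    rw [map_mul, hinv]
    linear_combination (-σ z) * hασ - σ α * z * hz)
  have hcb : c = b ^ 2 := by
    apply (algebraMap K (IntermediateField.adjoin K {ε 2})).injective
    rw [map_pow, hb]
    linear_combination (-(σ z) ^ 2) * ht' -
      algebraMap K _ c * (z * σ z + 1) * hz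
  refine ⟨b, ?_, hcb⟩
  rintro rfl
  have hσz : σ z ≠ 0 := right_ne_zero_of_mul_eq_one hz
  exact mul_ne_zero hα hσz (by rw [← hb, map_zero])
end
end

section
/- Suppose K is of type D with constant m or of type E with constant m. Let α ∈ K(ε_2)*, let c = N(α) ∈ K*, and suppose α^2 = c·ε_t for some natural number t with 0 ≤ t ≤ m − 2. Then c is a square in K*, i.e. c = c_1^2 for some c_1 ∈ K*. -/
noncomputable section

theorem inK_add_inv_of_succ {K : Type*} [Field K] {ε : ℕ → AlgebraicClosure K}
    (hε : ∀ n, ε n ≠ 0) (hcomp : ∀ n, ε (n + 1) ^ 2 = ε n) {n : ℕ}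
    (h : InK K (ε (n + 1) + (ε (n + 1))⁻¹)) : InK K (ε n + (ε n)⁻¹) := by
  obtain ⟨a, ha⟩ := h
  refine ⟨a ^ 2 - 2, ?_⟩
  have := hε (n + 1)
  rw [map_sub, map_pow, ha, map_ofNat, ← hcomp n]
  field_simp
  ring

theorem inK_add_inv_of_sub_inv_succ {K : Type*} [Field K] {ε : ℕ → AlgebraicClosure K}
    (hε : ∀ n, ε n ≠ 0) (hcomp : ∀ n, ε (n + 1) ^ 2 = ε n) {n : ℕ}
    (h : InK K (ε (n + 1) - (ε (n + 1))⁻¹)) : InK K (ε n + (ε n)⁻¹) := by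
  obtain ⟨a, ha⟩ := h
  refine ⟨a ^ 2 + 2, ?_⟩
  have := hε (n + 1)
  rw [map_add, map_pow, ha, map_ofNat, ← hcomp n]
  field_simp
  ring

theorem inK_add_inv_of_le {K : Type*} [Field K] {ε : ℕ → AlgebraicClosure K}
    (hε : ∀ n, ε n ≠ 0) (hcomp : ∀ n, ε (n + 1) ^ 2 = ε n) {k n : ℕ} (hkn : k ≤ n)
    (h : InK K (ε n + (ε n)⁻¹)) : InK K (ε k + (ε k)⁻¹) := by
  induction n, hkn using Nat.le_induction with
  | base => exact h
  | succ n _ ih => exact ih (inK_add_inv_of_succ hε hcomp h)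

theorem exists_eq_add_mul_of_mem_adjoin {K L : Type*} [Field K] [Field L] [Algebra K L]
    {i : L} (hi : i ^ 2 = -1) {z : L} (hz : z ∈ IntermediateField.adjoin K {i}) :
    ∃ x y : K, z = algebraMap K L x + algebraMap K L y * i := by
  have hint : IsIntegral K i := by
    refine IsIntegral.of_pow two_pos ?_
    rw [hi]
    exact isIntegral_one.neg
  rw [← IntermediateField.mem_toSubalgebra,
    IntermediateField.adjoin_simple_toSubalgebra_of_isAlgebraic hint.isAlgebraic] at hz
  induction hz using Algebra.adjoin_induction with
  | mem w hw => exact ⟨0, 1, by simpa using hw⟩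
  | algebraMap r => exact ⟨r, 0, by simp⟩
  | add _ _ _ _ hu hv =>
    obtain ⟨x, y, rfl⟩ := hu
    obtain ⟨x', y', rfl⟩ := hv
    exact ⟨x + x', y + y', by simp only [map_add]; ring⟩
  | mul _ _ _ _ hu hv =>
    obtain ⟨x, y, rfl⟩ := hu
    obtain ⟨x', y', rfl⟩ := hv
    refine ⟨x * x' - y * y', x * y' + y * x', ?_⟩
    simp only [map_add, map_sub, map_mul]
    linear_combination algebraMap K L y * algebraMap K L y' * hi

/-- A nontrivial automorphism of `K(i)`, where `i ^ 2 = -1`, acts as conjugation. -/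
theorem exists_eq_add_mul_and_conj {K L : Type*} [Field K] [Field L] [Algebra K L]
    {i : L} (hi : i ^ 2 = -1)
    (σ : IntermediateField.adjoin K {i} ≃ₐ[K] IntermediateField.adjoin K {i})
    (hσ : σ ≠ AlgEquiv.refl) (z : IntermediateField.adjoin K {i}) :
    ∃ x y : K, (z : L) = algebraMap K L x + algebraMap K L y * i ∧
      (σ z : L) = algebraMap K L x - algebraMap K L y * i := by
  set j : IntermediateField.adjoin K {i} :=
    ⟨i, IntermediateField.mem_adjoin_simple_self K i⟩
  have hdecomp (w : IntermediateField.adjoin K {i}) :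
      ∃ x y : K, w = algebraMap K _ x + algebraMap K _ y * j := by
    obtain ⟨x, y, h⟩ := exists_eq_add_mul_of_mem_adjoin hi w.2
    exact ⟨x, y, Subtype.ext h⟩
  have hjsq : j ^ 2 = -1 := Subtype.ext hi
  have hσj : σ j = -j := by
    have hsq : σ j ^ 2 = j ^ 2 := by rw [← map_pow, hjsq, map_neg, map_one]
    refine (sq_eq_sq_iff_eq_or_eq_neg.mp hsq).resolve_left fun hfix => hσ ?_
    ext1 w
    obtain ⟨x, y, rfl⟩ := hdecomp w
    simp [hfix]
  obtain ⟨x, y, rfl⟩ := hdecomp z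
  refine ⟨x, y, rfl, ?_⟩
  rw [map_add, map_mul, AlgEquiv.commutes, AlgEquiv.commutes, hσj, mul_neg, ← sub_eq_add_neg]
  rfl

/-- Lemma 2, case 2): type D or E with constant `m`, `0 ≤ t ≤ m - 2`.  If
`α ∈ K(ε₂)*`, `c = N(α) ∈ K*` and `α² = c·ε_t`, then `c` is a square in `K*`. -/
theorem stmt_4 (K : Type*) [Field K] (h2 : (2 : K) ≠ 0)
    (ε : ℕ → AlgebraicClosure K)
    (hprim : ∀ n : ℕ, IsPrimitiveRoot (ε n) (2 ^ n))
    (hcomp : ∀ n : ℕ, ε (n + 1) ^ 2 = ε n)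
    (m : ℕ) (hDE : TypeDc K ε m ∨ TypeEc K ε m)
    (σ : (IntermediateField.adjoin K {ε 2}) ≃ₐ[K] (IntermediateField.adjoin K {ε 2}))
    (hσ : σ ≠ AlgEquiv.refl)
    (α : IntermediateField.adjoin K {ε 2}) (hα : α ≠ 0)
    (c : K) (hc : algebraMap K (IntermediateField.adjoin K {ε 2}) c = α * σ α)
    (t : ℕ) (htm : t ≤ m - 2)
    (ht : (α : AlgebraicClosure K) ^ 2 = algebraMap K (AlgebraicClosure K) c * ε t) :
    ∃ c₁ : K, c₁ ≠ 0 ∧ c = c₁ ^ 2 := by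
  have hε (n : ℕ) : ε n ≠ 0 := (hprim n).ne_zero (by positivity)
  have hi : ε 2 ^ 2 = -1 := by
    rw [hcomp 1]
    exact (hprim 1).eq_neg_one_of_two_right
  have hm : 2 ≤ m := by
    rcases hDE with h | h
    · exact h.2.1
    · exact le_trans (by norm_num) h.2.1
  have htrace : InK K (ε (t + 1) + (ε (t + 1))⁻¹) := by
    rcases hDE with h | h
    · exact inK_add_inv_of_le hε hcomp (by omega) h.2.2.1
    · obtain ⟨n, rfl⟩ : ∃ n, m = n + 1 := ⟨m - 1, by omega⟩
      exact inK_add_inv_of_le hε hcomp (by omega) (inK_add_inv_of_sub_inv_succ hε hcomp h.2.2)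
  obtain ⟨a, ha⟩ := htrace
  obtain ⟨x, y, hxy, hσxy⟩ := exists_eq_add_mul_and_conj hi σ hσ α
  have hinj := (algebraMap K (AlgebraicClosure K)).injective
  have hα' : (α : AlgebraicClosure K) ≠ 0 := by simpa using hα
  have hcα : algebraMap K (AlgebraicClosure K) c = α * σ α := congrArg Subtype.val hc
  have hc0 : c ≠ 0 := by
    rintro rfl
    rw [map_zero, zero_mul] at ht
    exact hα' ((pow_eq_zero_iff two_ne_zero).mp ht)
  suffices ∃ c₁ : K, c = c₁ ^ 2 by
    obtain ⟨c₁, rfl⟩ := this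
    exact ⟨c₁, fun h => hc0 (by simp [h]), rfl⟩
  by_cases hx : x = 0
  · refine ⟨y, hinj ?_⟩
    rw [hcα, hxy, hσxy, hx, map_zero, map_pow]
    linear_combination -(algebraMap K (AlgebraicClosure K) y) ^ 2 * hi
  · have hconj : (α : AlgebraicClosure K) = σ α * ε (t + 1) ^ 2 := by
      apply mul_left_cancel₀ hα'
      rw [hcomp, ← mul_assoc, ← hcα, ← ht, sq]
    have hsum : (α : AlgebraicClosure K) + σ α =
        σ α * ε (t + 1) * algebraMap K (AlgebraicClosure K) a := by
      have := hε (t + 1)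
      rw [ha]
      field_simp
      linear_combination hconj
    have hsq : (2 * x) ^ 2 = c * a ^ 2 := by
      apply hinj
      have htr : algebraMap K (AlgebraicClosure K) (2 * x) = α + σ α := by
        rw [hxy, hσxy, map_mul, map_ofNat]
        ring
      rw [map_pow, htr, hsum, map_mul, map_pow, hcα]
      linear_combination -(σ α : AlgebraicClosure K) *
        algebraMap K (AlgebraicClosure K) a ^ 2 * hconj
    have ha0 : a ≠ 0 := by
      rintro rfl
      simp [h2, hx] at hsq
    refine ⟨2 * x / a, ?_⟩
    rw [div_pow, hsq]
    field_simp
end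
end

section
/- Let α ∈ K(ε_2)*, let c = N(α) ∈ K*, and suppose α^2 = c·ε_{m−1}. If K is of type D with constant m, then c = c_1^2 for some c_1 ∈ K*; if K is of type E with constant m, then c = −c_1^2 for some c_1 ∈ K*. -/
noncomputable section

open IntermediateField in
/-- A nontrivial automorphism of `K(i)/K` with `i ^ 2 = -1`, `i ∉ K` has fixed field `K`. -/
theorem exists_algebraMap_eq_of_fixed {K E : Type*} [Field K] [Field E] [Algebra K E] {i : E}
    (hi : i ^ 2 = -1) (hiK : i ∉ Set.range (algebraMap K E))
    (σ : K⟮i⟯ ≃ₐ[K] K⟮i⟯) (hσ : σ ≠ AlgEquiv.refl) {β : K⟮i⟯} (hβ : σ β = β) :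
    ∃ b : K, algebraMap K K⟮i⟯ b = β := by
  have haeval : Polynomial.aeval i (Polynomial.X ^ 2 + 1 : Polynomial K) = 0 := by simp [hi]
  have hmonic : (Polynomial.X ^ 2 + 1 : Polynomial K).Monic := by monicity!
  have hint : IsIntegral K i := ⟨_, hmonic, by rwa [← Polynomial.aeval_def]⟩
  have hdeg : (minpoly K i).natDegree = 2 := by
    refine le_antisymm ?_ ((minpoly.two_le_natDegree_iff hint).2 hiK)
    refine (Polynomial.natDegree_le_of_dvd (minpoly.dvd K i haeval) hmonic.ne_zero).trans ?_
    compute_degree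
  have hprime : (Module.finrank K K⟮i⟯).Prime := by
    rw [adjoin.finrank hint, hdeg]
    exact Nat.prime_two
  have := isSimpleOrder_of_finrank_prime K K⟮i⟯ hprime
  have hmem : β ∈ fixedField (Subgroup.zpowers σ) := by
    rw [mem_fixedField_iff]
    intro f hf
    exact (Subgroup.zpowers_le (H := MulAction.stabilizer (K⟮i⟯ ≃ₐ[K] K⟮i⟯) β)).2
      (MulAction.mem_stabilizer_iff.2 hβ) hf
  rcases eq_bot_or_eq_top (fixedField (Subgroup.zpowers σ)) with h | h
  · rw [h] at hmem
    exact mem_bot.1 hmem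
  · refine absurd (AlgEquiv.ext fun z => ?_) hσ
    have hz : z ∈ fixedField (Subgroup.zpowers σ) := h ▸ mem_top
    exact (mem_fixedField_iff _ z).1 hz σ (Subgroup.mem_zpowers σ)

open IntermediateField in
theorem map_eq_neg_of_sq_eq_neg_one {K E : Type*} [Field K] [Field E] [Algebra K E] {i : E}
    (hi : i ^ 2 = -1) (hiK : i ∉ Set.range (algebraMap K E))
    (σ : K⟮i⟯ ≃ₐ[K] K⟮i⟯) (hσ : σ ≠ AlgEquiv.refl) :
    σ (AdjoinSimple.gen K i) = -AdjoinSimple.gen K i := by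
  have hg : (AdjoinSimple.gen K i) ^ 2 = -1 := Subtype.ext (by simpa using hi)
  have hsq : σ (AdjoinSimple.gen K i) ^ 2 = AdjoinSimple.gen K i ^ 2 := by
    rw [← map_pow, hg, map_neg, map_one]
  refine (sq_eq_sq_iff_eq_or_eq_neg.1 hsq).resolve_left fun h => hiK ?_
  obtain ⟨b, hb⟩ := exists_algebraMap_eq_of_fixed hi hiK σ hσ h
  exact ⟨b, by simpa using congrArg (algebraMap K⟮i⟯ E) hb⟩

open IntermediateField in
/-- If `α ^ 2 = N(α) x ^ 2` and `x ^ 2 ≠ -1`, then `N(α)` is a square times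
`(x + x⁻¹) ^ 2`. -/
theorem exists_eq_sq_mul_add_inv_sq {K E : Type*} [Field K] [Field E] [Algebra K E] {i : E}
    (hi : i ^ 2 = -1) (hiK : i ∉ Set.range (algebraMap K E))
    (σ : K⟮i⟯ ≃ₐ[K] K⟮i⟯) (hσ : σ ≠ AlgEquiv.refl) {α : K⟮i⟯} (hα : α ≠ 0) {c : K}
    (hc : algebraMap K K⟮i⟯ c = α * σ α) {x : E} (hx : x ≠ 0) (hx1 : x ^ 2 ≠ -1)
    (ht : (α : E) ^ 2 = algebraMap K E c * x ^ 2) :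
    ∃ b : K, algebraMap K E c = algebraMap K E b ^ 2 * (x + x⁻¹) ^ 2 := by
  have hσα : σ α ≠ 0 := by simpa using hα
  have hαE : (α : E) ≠ 0 := by simpa using hα
  have hσαE : ((σ α : K⟮i⟯) : E) ≠ 0 := by simpa using hσα
  have hcE : algebraMap K E c = (α : E) * (σ α : K⟮i⟯) := by
    simpa using congrArg (algebraMap K⟮i⟯ E) hc
  have hxα : (α : E) = (σ α : K⟮i⟯) * x ^ 2 := by
    rw [hcE] at ht
    apply mul_left_cancel₀ hαE
    linear_combination ht
  have hσσ : σ (σ α) = α := by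
    have h := congrArg σ hc
    rw [AlgEquiv.commutes, map_mul, hc] at h
    apply mul_left_cancel₀ hσα
    linear_combination -h
  have hsum : σ α + α ≠ 0 := fun h => hx1 <| by
    have h' : ((σ α : K⟮i⟯) : E) + α = 0 := by simpa using congrArg (algebraMap K⟮i⟯ E) h
    apply mul_left_cancel₀ hσαE
    linear_combination h' - hxα
  obtain ⟨b, hb⟩ := exists_algebraMap_eq_of_fixed hi hiK σ hσ
    (β := α * σ α / (σ α + α)) (by
      rw [map_div₀, map_mul, map_add, hσσ, mul_comm, add_comm])
  refine ⟨b, ?_⟩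
  have hbE : algebraMap K E b = (α : E) * (σ α : K⟮i⟯) / ((σ α : K⟮i⟯) + α) := by
    simpa using congrArg (algebraMap K⟮i⟯ E) hb
  have hx2 : 1 + x ^ 2 ≠ 0 := fun h => hx1 (by linear_combination h)
  rw [hbE, hcE, hxα]
  generalize ((σ α : K⟮i⟯) : E) = s at *
  have : s + s * x ^ 2 = s * (1 + x ^ 2) := by ring
  rw [this]
  field_simp
  ring

open IntermediateField in
/-- If `α ^ 2 = N(α) x ^ 2` and `x ^ 2 ≠ 1`, then `-N(α)` is a square times
`(x - x⁻¹) ^ 2`. -/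
theorem exists_eq_neg_sq_mul_sub_inv_sq {K E : Type*} [Field K] [Field E] [Algebra K E] {i : E}
    (hi : i ^ 2 = -1) (hiK : i ∉ Set.range (algebraMap K E))
    (σ : K⟮i⟯ ≃ₐ[K] K⟮i⟯) (hσ : σ ≠ AlgEquiv.refl) {α : K⟮i⟯} (hα : α ≠ 0) {c : K}
    (hc : algebraMap K K⟮i⟯ c = α * σ α) {x : E} (hx : x ≠ 0) (hx1 : x ^ 2 ≠ 1)
    (ht : (α : E) ^ 2 = algebraMap K E c * x ^ 2) :
    ∃ b : K, algebraMap K E c = -(algebraMap K E b ^ 2 * (x - x⁻¹) ^ 2) := by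
  have hgi := map_eq_neg_of_sq_eq_neg_one hi hiK σ hσ
  have hi0 : i ≠ 0 := by rintro rfl; simp at hi
  have hg0 : AdjoinSimple.gen K i ≠ 0 := fun h => hi0 <| by
    simpa using congrArg (algebraMap K⟮i⟯ E) h
  have hg : (AdjoinSimple.gen K i) ^ 2 = -1 := Subtype.ext (by simpa using hi)
  obtain ⟨b, hb⟩ := exists_eq_sq_mul_add_inv_sq hi hiK σ hσ
    (α := AdjoinSimple.gen K i * α) (mul_ne_zero hg0 hα) (c := c)
    (by rw [map_mul, hgi, hc]; linear_combination (α * σ α) * hg)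
    (x := i * x) (mul_ne_zero hi0 hx)
    (by rw [mul_pow, hi]; intro h; exact hx1 (by linear_combination -h))
    (by push_cast; rw [AdjoinSimple.coe_gen, mul_pow, mul_pow, ht]; ring)
  refine ⟨b, ?_⟩
  have hinv : i⁻¹ = -i := inv_eq_of_mul_eq_one_right (by linear_combination -hi)
  rw [hb, mul_inv, hinv]
  linear_combination (algebraMap K E b ^ 2 * (x - x⁻¹) ^ 2) * hi

/-- Lemma 2, case 3): `t = m - 1`.  If `α ∈ K(ε₂)*`, `c = N(α) ∈ K*` and
`α² = c·ε_{m-1}`, then `c ∈ K*²` if `K` is of type D with constant `m` and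
`c ∈ -K*²` if `K` is of type E with constant `m`. -/
theorem stmt_5 (K : Type*) [Field K] (h2 : (2 : K) ≠ 0)
    (ε : ℕ → AlgebraicClosure K)
    (hprim : ∀ n : ℕ, IsPrimitiveRoot (ε n) (2 ^ n))
    (hcomp : ∀ n : ℕ, ε (n + 1) ^ 2 = ε n)
    (m : ℕ)
    (σ : (IntermediateField.adjoin K {ε 2}) ≃ₐ[K] (IntermediateField.adjoin K {ε 2}))
    (hσ : σ ≠ AlgEquiv.refl)
    (α : IntermediateField.adjoin K {ε 2}) (hα : α ≠ 0)
    (c : K) (hc : algebraMap K (IntermediateField.adjoin K {ε 2}) c = α * σ α)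
    (ht : (α : AlgebraicClosure K) ^ 2 = algebraMap K (AlgebraicClosure K) c * ε (m - 1)) :
    (TypeDc K ε m → ∃ c₁ : K, c₁ ≠ 0 ∧ c = c₁ ^ 2) ∧
    (TypeEc K ε m → ∃ c₁ : K, c₁ ≠ 0 ∧ c = -c₁ ^ 2) := by
  have hc0 : c ≠ 0 := by
    rintro rfl
    rw [map_zero] at hc
    exact (mul_ne_zero hα (by simpa using hα)) hc.symm
  have hinj := (algebraMap K (AlgebraicClosure K)).injective
  have hε1 : ε 1 = -1 := by
    have h := hprim 1
    rw [pow_one] at h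
    exact h.eq_neg_one_of_two_right
  have hi : ε 2 ^ 2 = -1 := by rw [hcomp 1, hε1]
  have hx0 : ε m ≠ 0 := (hprim m).ne_zero (by positivity)
  have hnegone : ∀ n, 2 ≤ n → ε n ≠ -1 ∧ ε n ≠ 1 := by
    intro n hn
    have hord := (hprim n).eq_orderOf
    have h4 : 4 ≤ 2 ^ n := (Nat.pow_le_pow_right two_pos hn : 2 ^ 2 ≤ 2 ^ n)
    constructor <;> intro h <;> rw [h] at hord
    · have := orderOf_le_of_pow_eq_one (x := (-1 : AlgebraicClosure K)) two_pos (by norm_num)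
      omega
    · rw [orderOf_one] at hord
      omega
  have hsq : 1 ≤ m → ε m ^ 2 = ε (m - 1) := fun hm => by
    rw [← hcomp (m - 1), Nat.sub_add_cancel hm]
  have h2' : (2 : AlgebraicClosure K) ≠ 0 := by
    simpa only [map_ofNat, map_zero] using hinj.ne h2
  constructor
  · rintro ⟨hiK, hm, ⟨t, hT⟩, -, -⟩
    rw [← hsq (by omega)] at ht
    suffices h : ∃ d : K, c = d ^ 2 by
      obtain ⟨d, rfl⟩ := h
      exact ⟨d, fun h => hc0 (by rw [h]; ring), rfl⟩
    rcases hm.eq_or_lt with rfl | hm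
    · obtain ⟨b, hb⟩ := exists_eq_neg_sq_mul_sub_inv_sq hi hiK σ hσ hα hc hx0
        (by rw [hi]; intro h; exact h2' (by linear_combination -h)) ht
      have hinv : (ε 2)⁻¹ = -ε 2 := inv_eq_of_mul_eq_one_right (by linear_combination -hi)
      refine ⟨2 * b, hinj ?_⟩
      rw [hb, hinv, map_pow, map_mul, map_ofNat]
      linear_combination (-4 * algebraMap K (AlgebraicClosure K) b ^ 2) * hi
    · obtain ⟨b, hb⟩ := exists_eq_sq_mul_add_inv_sq hi hiK σ hσ hα hc hx0
        (by rw [hsq (by omega)]; exact (hnegone _ (by omega)).1) ht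
      exact ⟨b * t, hinj (by rw [hb, ← hT, map_pow, map_mul, mul_pow])⟩
  · rintro ⟨hiK, hm, ⟨t, hT⟩⟩
    rw [← hsq (by omega)] at ht
    obtain ⟨b, hb⟩ := exists_eq_neg_sq_mul_sub_inv_sq hi hiK σ hσ hα hc hx0
      (by rw [hsq (by omega)]; exact (hnegone _ (by omega)).2) ht
    have h : c = -(b * t) ^ 2 := hinj (by rw [hb, ← hT, map_neg, map_pow, map_mul, mul_pow])
    exact ⟨b * t, fun h' => hc0 (by rw [h, h']; ring), h⟩
end
end

section
/- Suppose K is of type D with constant m or of type E with constant m, and let s be a natural number with 1 ≤ s ≤ m − 1. Then K_s = ⟨−1⟩ × K*^{2^s}, i.e. an element a ∈ K* satisfies a = α^{2^s} for some α ∈ K(ε_2)* if and only if a = b^{2^s} or a = −b^{2^s} for some b ∈ K*. -/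
noncomputable section

section

variable {K : Type*} [Field K]

/-- If `e` satisfies a monic quadratic equation over `K`, then every power of `e` lies in
`K + K e`. -/
lemma exists_pow_eq_add_mul {e : AlgebraicClosure K} {c d : K}
    (h : e ^ 2 = algebraMap K _ c * e + algebraMap K _ d) (n : ℕ) :
    ∃ p q : K, e ^ n = algebraMap K _ p + algebraMap K _ q * e := by
  induction n with
  | zero => exact ⟨1, 0, by simp⟩
  | succ n ih =>
    obtain ⟨p, q, hpq⟩ := ih
    refine ⟨q * d, p + q * c, ?_⟩
    rw [pow_succ, hpq]
    simp only [map_add, map_mul]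
    linear_combination algebraMap K (AlgebraicClosure K) q * h

/-- If `e` is quadratic over `K` and some power of `e` is not in `K`, then `e` lies in the field
generated by that power. -/
lemma mem_adjoin_pow_of_quadratic {e : AlgebraicClosure K} {c d : K}
    (h : e ^ 2 = algebraMap K _ c * e + algebraMap K _ d) (n : ℕ) (hn : ¬InK K (e ^ n)) :
    e ∈ IntermediateField.adjoin K {e ^ n} := by
  obtain ⟨p, q, hpq⟩ := exists_pow_eq_add_mul h n
  have hq : q ≠ 0 := by
    rintro rfl
    exact hn ⟨p, by simp [hpq]⟩
  have hq' : algebraMap K (AlgebraicClosure K) q ≠ 0 := by simpa using hq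
  have he : e = (e ^ n - algebraMap K _ p) / algebraMap K _ q := by
    rw [hpq]
    field_simp
    ring
  have := div_mem (sub_mem (IntermediateField.mem_adjoin_simple_self K (e ^ n))
    (IntermediateField.algebraMap_mem _ p)) (IntermediateField.algebraMap_mem _ q)
  rwa [← he] at this

lemma exists_eq_add_mul_of_mem_adjoin_s8 {i x : AlgebraicClosure K} (hi : i ^ 2 = -1)
    (hx : x ∈ IntermediateField.adjoin K {i}) :
    ∃ p q : K, x = algebraMap K _ p + algebraMap K _ q * i := by
  have hint : IsIntegral K i := Algebra.IsIntegral.isIntegral i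
  rw [← IntermediateField.mem_toSubalgebra,
    IntermediateField.adjoin_simple_toSubalgebra_of_isAlgebraic hint.isAlgebraic] at hx
  induction hx using Algebra.adjoin_induction with
  | mem y hy => exact ⟨0, 1, by simpa using hy⟩
  | algebraMap r => exact ⟨r, 0, by simp⟩
  | add y z _ _ hy hz =>
    obtain ⟨p, q, rfl⟩ := hy
    obtain ⟨p', q', rfl⟩ := hz
    exact ⟨p + p', q + q', by simp only [map_add]; ring⟩
  | mul y z _ _ hy hz =>
    obtain ⟨p, q, rfl⟩ := hy
    obtain ⟨p', q', rfl⟩ := hz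
    refine ⟨p * p' - q * q', p * q' + q * p', ?_⟩
    simp only [map_add, map_sub, map_mul]
    linear_combination algebraMap K (AlgebraicClosure K) q * algebraMap K _ q' * hi

/-- A square root of `-1` outside `K` is moved to its negative by an automorphism of `K̄`. -/
lemma exists_algEquiv_eq_neg (h2 : (2 : K) ≠ 0) {i : AlgebraicClosure K} (hi : i ^ 2 = -1)
    (hiK : ¬InK K i) :
    ∃ σ : AlgebraicClosure K ≃ₐ[K] AlgebraicClosure K, σ i = -i := by
  have hsep : IsSeparable K i := by
    have hX : (Polynomial.X ^ 2 - Polynomial.C (-1) : Polynomial K).Separable :=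
      Polynomial.separable_X_pow_sub_C (-1) (by exact_mod_cast h2) (neg_ne_zero.2 one_ne_zero)
    exact hX.of_dvd (minpoly.dvd K i (by simp [hi]))
  obtain ⟨j, hne, hj⟩ := (notMem_iff_exists_ne_and_isConjRoot (K := K) hsep
    (IsAlgClosed.splits _)).1 (fun h => hiK (Algebra.mem_bot.1 h))
  obtain ⟨σ, rfl⟩ := isConjRoot_iff_exists_algEquiv.1 hj.symm
  refine ⟨σ, ?_⟩
  have h : (σ i) ^ 2 = i ^ 2 := by rw [← map_pow, hi]; simp
  exact (sq_eq_sq_iff_eq_or_eq_neg.1 h).resolve_left (Ne.symm hne)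

/-- Elements of `K(i)` fixed by the conjugation lie in `K`. -/
lemma inK_of_conj_eq (h2 : (2 : K) ≠ 0) {i x : AlgebraicClosure K} (hi : i ^ 2 = -1)
    {σ : AlgebraicClosure K ≃ₐ[K] AlgebraicClosure K} (hσ : σ i = -i)
    (hx : x ∈ IntermediateField.adjoin K {i}) (h : σ x = x) : InK K x := by
  obtain ⟨p, q, rfl⟩ := exists_eq_add_mul_of_mem_adjoin_s8 hi hx
  have h2' : (2 : AlgebraicClosure K) ≠ 0 := by
    rw [← map_ofNat (algebraMap K (AlgebraicClosure K)) 2]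
    exact (map_ne_zero _).2 h2
  simp only [map_add, map_mul, AlgEquiv.commutes, hσ] at h
  have hq : 2 * (algebraMap K (AlgebraicClosure K) q * i) = 0 := by linear_combination -h
  exact ⟨p, by simp [(mul_eq_zero.1 hq).resolve_left h2']⟩

/-- Suppose `e ∈ K(i)` has `e ^ 2 ^ s = -1` and conjugate `± e⁻¹`, with the sign `-` only if
`2 ≤ s`. If `α ∈ K(i)` has conjugate `(e ^ 2) ^ j * α` and `α ^ 2 ^ s ∈ K`, then `α ^ 2 ^ s` is up
to sign a `2 ^ s`-th power from `K`. -/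
lemma exists_eq_pow_or_neg_pow (h2 : (2 : K) ≠ 0) {i e α : AlgebraicClosure K} {a : K} {s j : ℕ}
    (hi : i ^ 2 = -1) {σ : AlgebraicClosure K ≃ₐ[K] AlgebraicClosure K} (hσ : σ i = -i)
    (he : e ∈ IntermediateField.adjoin K {i}) (hes : e ^ 2 ^ s = -1)
    (hσe : σ e * e = 1 ∨ 2 ≤ s ∧ σ e * e = -1)
    (hα : α ∈ IntermediateField.adjoin K {i}) (hσα : σ α = (e ^ 2) ^ j * α)
    (ha : algebraMap K _ a = α ^ 2 ^ s) :
    ∃ b : K, a = b ^ 2 ^ s ∨ a = -b ^ 2 ^ s := by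
  have hmem : e ^ j * α ∈ IntermediateField.adjoin K {i} := mul_mem (pow_mem he j) hα
  have hσt : σ (e ^ j * α) = (σ e * e) ^ j * (e ^ j * α) := by
    rw [map_mul, map_pow, hσα, mul_pow, ← pow_mul]
    ring
  have hb : ∃ b : K, (algebraMap K (AlgebraicClosure K) b) ^ 2 ^ s = (e ^ j * α) ^ 2 ^ s := by
    have hcases : σ (e ^ j * α) = e ^ j * α ∨ 2 ≤ s ∧ σ (e ^ j * α) = -(e ^ j * α) := by
      rcases hσe with h | ⟨hs, h⟩
      · left
        rw [hσt, h, one_pow, one_mul]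
      · rcases neg_one_pow_eq_or (AlgebraicClosure K) j with hj | hj
        · left
          rw [hσt, h, hj, one_mul]
        · exact Or.inr ⟨hs, by rw [hσt, h, hj, neg_one_mul]⟩
    rcases hcases with h | ⟨hs, h⟩
    · obtain ⟨b, hb⟩ := inK_of_conj_eq h2 hi hσ hmem h
      exact ⟨b, by rw [hb]⟩
    · obtain ⟨b, hb⟩ := inK_of_conj_eq h2 hi hσ
        (mul_mem hmem (IntermediateField.mem_adjoin_simple_self K i))
        (by rw [map_mul, h, hσ, neg_mul_neg])
      refine ⟨b, ?_⟩
      obtain ⟨k, rfl⟩ := Nat.exists_eq_add_of_le hs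
      have hi4 : i ^ 2 ^ (2 + k) = 1 := by
        rw [pow_add, pow_mul, show i ^ 2 ^ 2 = 1 by linear_combination (i ^ 2 - 1) * hi, one_pow]
      rw [hb, mul_pow _ i, hi4, mul_one]
  obtain ⟨b, hb⟩ := hb
  have hinj := (algebraMap K (AlgebraicClosure K)).injective
  rw [mul_pow, ← ha, ← pow_mul, mul_comm j, pow_mul, hes] at hb
  refine ⟨b, ?_⟩
  rcases neg_one_pow_eq_or (AlgebraicClosure K) j with hj | hj
  · left
    apply hinj
    rw [map_pow, hb, hj, one_mul]
  · right
    apply hinj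
    rw [map_neg, map_pow, hb, hj, neg_one_mul, neg_neg]

lemma compatible_pow_two_pow {ε : ℕ → AlgebraicClosure K} (hcomp : ∀ n : ℕ, ε (n + 1) ^ 2 = ε n)
    (n k : ℕ) : ε (n + k) ^ 2 ^ k = ε n := by
  induction k with
  | zero => simp
  | succ k ih => rw [pow_succ', pow_mul, ← add_assoc, hcomp, ih]

/-- If `e + u e⁻¹ ∈ K` with `u ∈ K`, and some power `i ∉ K` of `e` is moved by `σ`, then
`e ∈ K(i)` and `σ e = u e⁻¹`. -/
lemma mem_adjoin_and_conj_mul_self {e i : AlgebraicClosure K} {u : K} {n : ℕ} (he0 : e ≠ 0)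
    (h : InK K (e + algebraMap K _ u * e⁻¹)) (hei : e ^ n = i) (hiK : ¬InK K i)
    {σ : AlgebraicClosure K ≃ₐ[K] AlgebraicClosure K} (hσ : σ i ≠ i) :
    e ∈ IntermediateField.adjoin K {i} ∧ σ e * e = algebraMap K _ u := by
  obtain ⟨c, hc⟩ := h
  subst hei
  constructor
  · refine mem_adjoin_pow_of_quadratic (c := c) (d := -u) ?_ n hiK
    rw [hc, map_neg]
    field_simp
    ring
  · have hσ0 : σ e ≠ 0 := by simpa using he0
    have hσc := congrArg σ hc
    simp only [map_add, map_mul, map_inv₀, AlgEquiv.commutes] at hσc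
    rw [hc] at hσc
    have hprod : (σ e - e) * (σ e * e - algebraMap K _ u) = 0 := by
      field_simp at hσc
      linear_combination -hσc
    refine sub_eq_zero.1 ((mul_eq_zero.1 hprod).resolve_left fun h => hσ ?_)
    rw [map_pow, sub_eq_zero.1 h]

end


/-- Lemma 3, case 3): if `K` is of type D or E with constant `m` and
`1 ≤ s ≤ m - 1`, then `K_s = ⟨-1⟩ × K*^{2^s}`. -/
theorem stmt_8 (K : Type*) [Field K] (h2 : (2 : K) ≠ 0)
    (ε : ℕ → AlgebraicClosure K)
    (hprim : ∀ n : ℕ, IsPrimitiveRoot (ε n) (2 ^ n))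
    (hcomp : ∀ n : ℕ, ε (n + 1) ^ 2 = ε n)
    (m : ℕ) (hDE : TypeDc K ε m ∨ TypeEc K ε m)
    (s : ℕ) (hs1 : 1 ≤ s) (hsm : s ≤ m - 1) :
    ∀ a : K, a ≠ 0 →
      (MemKs K ε s a ↔ ∃ b : K, b ≠ 0 ∧ (a = b ^ 2 ^ s ∨ a = -b ^ 2 ^ s)) := by
  have hε1 : ε 1 = -1 := (hprim 1).eq_neg_one_of_two_right
  have hi : ε 2 ^ 2 = -1 := by rw [hcomp 1, hε1]
  have hiK : ¬InK K (ε 2) := hDE.elim (fun h => h.1) (fun h => h.1)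
  have hm2 : 2 ≤ m := hDE.elim (fun h => h.2.1) (fun h => le_trans (by norm_num) h.2.1)
  obtain ⟨σ, hσ⟩ := exists_algEquiv_eq_neg h2 hi hiK
  have hσne : σ (ε 2) ≠ ε 2 := by
    intro h
    have hmem := IntermediateField.mem_adjoin_simple_self K (ε 2)
    exact hiK (inK_of_conj_eq h2 hi hσ hmem h)
  have hem0 : ε m ≠ 0 := (hprim m).ne_zero (by positivity)
  have hpow : ε m ^ 2 ^ (m - 2) = ε 2 := by
    simpa [Nat.add_sub_cancel' hm2] using compatible_pow_two_pow hcomp 2 (m - 2)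
  have hm : ε m ∈ IntermediateField.adjoin K {ε 2} ∧
      (σ (ε m) * ε m = 1 ∨ 3 ≤ m ∧ σ (ε m) * ε m = -1) := by
    rcases hDE with ⟨-, -, hD, -⟩ | ⟨-, hm3, hE⟩
    · obtain ⟨h, h'⟩ := mem_adjoin_and_conj_mul_self (u := 1) hem0 (by simpa using hD) hpow hiK hσne
      exact ⟨h, Or.inl (by simpa using h')⟩
    · obtain ⟨h, h'⟩ := mem_adjoin_and_conj_mul_self (u := -1) hem0
        (by simpa [sub_eq_add_neg] using hE) hpow hiK hσne
      exact ⟨h, Or.inr ⟨hm3, by simpa using h'⟩⟩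
  obtain ⟨k, rfl⟩ : ∃ k, m = s + 1 + k := Nat.exists_eq_add_of_le (by omega)
  have hek := compatible_pow_two_pow hcomp (s + 1) k
  have he : ε (s + 1) ∈ IntermediateField.adjoin K {ε 2} := hek ▸ pow_mem hm.1 _
  have hes : ε (s + 1) ^ 2 ^ s = -1 := by
    rw [add_comm, compatible_pow_two_pow hcomp, hε1]
  have hσe : σ (ε (s + 1)) * ε (s + 1) = 1 ∨ 2 ≤ s ∧ σ (ε (s + 1)) * ε (s + 1) = -1 := by
    rw [← hek, map_pow, ← mul_pow]
    rcases hm.2 with h | ⟨h3, h⟩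
    · exact Or.inl (by rw [h, one_pow])
    · rcases k with _ | k
      · exact Or.inr ⟨by omega, by rw [h]; simp⟩
      · left
        rw [h, pow_succ', pow_mul]
        simp
  intro a ha0
  constructor
  · rintro ⟨α, hα, hα0, ha⟩
    have hroot : (σ α / α) ^ 2 ^ s = 1 := by
      rw [div_pow, ← map_pow, ← ha, AlgEquiv.commutes, div_self (by simpa using ha0)]
    have : NeZero (2 ^ s) := ⟨by positivity⟩
    obtain ⟨j, -, hj⟩ := (hprim s).eq_pow_of_pow_eq_one hroot
    have hσα : σ α = (ε (s + 1) ^ 2) ^ j * α := by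
      rw [hcomp, hj, div_mul_cancel₀ _ hα0]
    obtain ⟨b, hb⟩ := exists_eq_pow_or_neg_pow h2 hi hσ he hes hσe hα hσα ha
    refine ⟨b, ?_, hb⟩
    rintro rfl
    exact ha0 (by simpa using hb)
  · rintro ⟨b, hb0, rfl | rfl⟩
    · exact ⟨algebraMap K _ b, IntermediateField.algebraMap_mem _ b, by simpa using hb0, by simp⟩
    · refine ⟨ε (s + 1) * algebraMap K _ b,
        mul_mem he (IntermediateField.algebraMap_mem _ b),
        mul_ne_zero ((hprim _).ne_zero (by positivity)) (by simpa using hb0), ?_⟩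
      rw [mul_pow, hes, map_neg, map_pow, neg_one_mul]
end
end

section
/- Suppose ε_2 ∈ K. Let n ≥ 1, a ∈ K*, A = K[X]/(X^{2^n} − a) with ḡ the image of X, let s = H_n(a) (here K_s = K*^{2^s} since ε_2 ∈ K, so s is the greatest integer in [0, n] with a ∈ K*^{2^s}), and write a = b^{2^s} with b ∈ K*. Set h = ḡ^{2^{n−s}}·b^{−1} ∈ A. Then h^{2^s} = 1 and, if s ≥ 1, h^{2^{s−1}} ≠ 1 (so h has multiplicative order exactly 2^s), and the elements 1, h, h^2, …, h^{2^s−1} are linearly independent over K; hence the group algebra K⟨h⟩ embeds as a K-subalgebra of A. -/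
noncomputable section

/-- In `K[X]/(X^(d * m) - a)` the elements `(c * x^d)^i`, `i < m`, with `x` the image of `X` and
`c ∈ K` nonzero, are linearly independent over `K`. -/
theorem AdjoinRoot.linearIndependent_mul_root_pow {K : Type*} [Field K] {a c : K} (hc : c ≠ 0)
    {N d m : ℕ} (hN : 0 < N) (hdm : d * m = N) :
    LinearIndependent K (fun i : Fin m =>
      (algebraMap K (AdjoinRoot (Polynomial.X ^ N - Polynomial.C a)) c *
        AdjoinRoot.root (Polynomial.X ^ N - Polynomial.C a) ^ d) ^ (i : ℕ)) := by
  have hd : 0 < d := Nat.pos_of_ne_zero fun h0 => by simp [h0] at hdm; omega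
  have hlt (i : Fin m) : d * (i : ℕ) < N := hdm ▸ Nat.mul_lt_mul_of_pos_left i.2 hd
  have hroot : LinearIndependent K (fun i : Fin N =>
      AdjoinRoot.root (Polynomial.X ^ N - Polynomial.C a) ^ (i : ℕ)) := by
    let B := AdjoinRoot.powerBasis' (Polynomial.monic_X_pow_sub_C a hN.ne')
    have hdim : N = B.dim := by simp [B]
    simpa [B, Function.comp_def] using B.basis.linearIndependent.comp (Fin.cast hdim)
      (Fin.cast_injective hdim)
  have hsub := hroot.comp (fun i : Fin m => (⟨d * (i : ℕ), hlt i⟩ : Fin N)) fun i j hij =>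
    Fin.ext (Nat.eq_of_mul_eq_mul_left hd (congrArg Fin.val hij))
  convert hsub.units_smul (fun i : Fin m => Units.mk0 c hc ^ (i : ℕ)) using 1
  ext1 i
  simp [Units.smul_def, Algebra.smul_def, mul_pow, pow_mul]

/-- Theorem 1, part 1): `h = ḡ^{2^{n-s}}·b⁻¹` has order exactly `2^s` and its
powers `1, h, …, h^{2^s - 1}` are linearly independent over `K`. -/
theorem stmt_11 (K : Type*) [Field K] (h2 : (2 : K) ≠ 0)
    (ε : ℕ → AlgebraicClosure K)
    (hprim : ∀ n : ℕ, IsPrimitiveRoot (ε n) (2 ^ n))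
    (hcomp : ∀ n : ℕ, ε (n + 1) ^ 2 = ε n)
    (hε2 : InK K (ε 2))
    (n : ℕ) (hn : 1 ≤ n) (a : K) (ha : a ≠ 0)
    -- `s = H_n(a)`:
    (s : ℕ) (hsn : s ≤ n) (hmem : MemKs K ε s a)
    (hmax : ∀ t : ℕ, t ≤ n → MemKs K ε t a → t ≤ s)
    (b : K) (hb : b ≠ 0) (hab : a = b ^ 2 ^ s)
    -- `ḡ` is the image of `X` in `A = K[X]/(X^{2^n} - a)`:
    (g : AdjoinRoot (Polynomial.X ^ 2 ^ n - Polynomial.C a))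
    (hg : g = AdjoinRoot.root (Polynomial.X ^ 2 ^ n - Polynomial.C a))
    (h : AdjoinRoot (Polynomial.X ^ 2 ^ n - Polynomial.C a))
    (hh : h = algebraMap K (AdjoinRoot (Polynomial.X ^ 2 ^ n - Polynomial.C a)) b⁻¹ *
      g ^ 2 ^ (n - s)) :
    h ^ 2 ^ s = 1 ∧ (1 ≤ s → h ^ 2 ^ (s - 1) ≠ 1) ∧
      LinearIndependent K (fun i : Fin (2 ^ s) => h ^ (i : ℕ)) := by
  have hli : LinearIndependent K (fun i : Fin (2 ^ s) => h ^ (i : ℕ)) := by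
    rw [hh, hg]
    exact AdjoinRoot.linearIndependent_mul_root_pow (inv_ne_zero hb) (by positivity)
      (by rw [← pow_add, Nat.sub_add_cancel hsn])
  have hroot : g ^ 2 ^ n = algebraMap K _ a := by
    have heval := AdjoinRoot.eval₂_root (Polynomial.X ^ 2 ^ n - Polynomial.C a)
    rw [Polynomial.eval₂_sub, Polynomial.eval₂_X_pow, Polynomial.eval₂_C, sub_eq_zero] at heval
    rw [hg, heval, AdjoinRoot.algebraMap_eq]
  refine ⟨?_, fun hs hpow => ?_, hli⟩
  · rw [hh, mul_pow, ← pow_mul, ← pow_add, Nat.sub_add_cancel hsn, hroot, ← map_pow, ← map_mul,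
      hab, ← mul_pow, inv_mul_cancel₀ hb, one_pow, map_one]
  · have heq := hli.injective
      (a₁ := ⟨2 ^ (s - 1), Nat.pow_lt_pow_right one_lt_two (by omega)⟩)
      (a₂ := ⟨0, by positivity⟩) (by simpa using hpow)
    exact (pow_pos two_pos (s - 1)).ne' (congrArg Fin.val heq)
end
end

section
/- Suppose ε_2 ∈ K. Let n ≥ 1, a ∈ K*, A = K[X]/(X^{2^n} − a) with ḡ the image of X, let s = H_n(a) (here K_s = K*^{2^s} since ε_2 ∈ K), write a = b^{2^s} with b ∈ K*, and set h = ḡ^{2^{n−s}}·b^{−1} ∈ A and let B be the K-subalgebra of A spanned by 1, h, h^2, …, h^{2^s−1}. Then the set of minimal idempotents of A coincides with the set of minimal idempotents of B; that is, an element e ∈ A is a minimal idempotent of A if and only if e ∈ B and e is a minimal idempotent of the K-algebra B. -/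
noncomputable section

open Polynomial in
/-- If `-1` is a square and `c` is not, then `X ^ 2 ^ d - c` is irreducible. -/
theorem irreducible_X_pow_two_pow_sub_C {K : Type*} [Field K] (hi : ∃ i : K, i ^ 2 = -1) {c : K}
    (hc : ∀ t : K, t ^ 2 ≠ c) (d : ℕ) : Irreducible (X ^ 2 ^ d - C c) := by
  induction d with
  | zero => simpa using irreducible_X_sub_C c
  | succ d ih =>
    rw [pow_succ']
    rcases Nat.eq_zero_or_pos d with rfl | hd
    · simpa using X_pow_sub_C_irreducible_of_prime Nat.prime_two hc
    refine X_pow_mul_sub_C_irreducible ih fun E _ _ x hx ↦ ?_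
    refine X_pow_sub_C_irreducible_of_prime Nat.prime_two fun z hz ↦ ?_
    have hx' : IsIntegral K x := not_not.mp fun h ↦ by
      have h0 := hx.symm.trans (minpoly.eq_zero h)
      exact X_pow_sub_C_ne_zero (by positivity) c h0
    obtain ⟨i, hi⟩ := hi
    have key := congrArg (Algebra.norm K) hz
    rw [map_pow, ← IntermediateField.adjoin.powerBasis_gen hx',
      Algebra.PowerBasis.norm_gen_eq_coeff_zero_minpoly] at key
    have hev : Even (2 ^ d) := (even_two).pow_of_ne_zero hd.ne'
    simp [IntermediateField.minpoly_gen, hx, hev.neg_one_pow, (pow_ne_zero d two_ne_zero).symm] at key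
    exact hc (i * Algebra.norm K z) (by rw [mul_pow, hi, key]; ring)

open Polynomial in
/-- If `L = K[y]` is a field in which `y` is a square, `y ^ 2 ^ N = a ∈ K`, and `-1` is a square in
`K`, then `a` is a `2 ^ (N + 1)`-th power in `K`. -/
theorem exists_pow_eq_of_isSquare_generator {K L : Type*} [Field K] [Field L] [Algebra K L]
    (hi : ∃ i : K, i ^ 2 = -1) {y z : L} {N : ℕ} {a : K}
    (hy : y ^ 2 ^ N = algebraMap K L a) (hgen : Algebra.adjoin K {y} = ⊤) (hz : z ^ 2 = y) :
    ∃ c : K, c ^ 2 ^ (N + 1) = a := by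
  classical
  have hex : ∃ d, ∃ c : K, algebraMap K L c = y ^ 2 ^ d := ⟨N, a, hy.symm⟩
  obtain ⟨c, hc⟩ := Nat.find_spec hex
  have hmin := fun m (hm : m < Nat.find hex) ↦ Nat.find_min hex hm
  generalize Nat.find hex = d at hc hmin
  rcases d with _ | d
  · have hbot : (⊤ : Subalgebra K L) = ⊥ := by
      rw [← hgen, eq_bot_iff, Algebra.adjoin_le_iff, Set.singleton_subset_iff]
      exact Algebra.mem_bot.2 ⟨c, by simpa using hc⟩
    obtain ⟨t, ht⟩ := Algebra.mem_bot.1 (hbot ▸ Algebra.mem_top : z ∈ (⊥ : Subalgebra K L))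
    refine ⟨t, (algebraMap K L).injective ?_⟩
    rw [map_pow, ht, pow_succ', pow_mul, hz, hy]
  · exfalso
    obtain ⟨i, hi⟩ := hi
    have hns : ∀ t : K, t ^ 2 ≠ c := by
      intro t ht
      have h1 : (algebraMap K L t) ^ 2 = (y ^ 2 ^ d) ^ 2 := by
        rw [← map_pow, ht, hc, ← pow_mul, ← pow_succ]
      rcases sq_eq_sq_iff_eq_or_eq_neg.1 h1 with h | h
      · exact hmin d (Nat.lt_succ_self d) ⟨t, h⟩
      · exact hmin d (Nat.lt_succ_self d) ⟨-t, by rw [map_neg, h, neg_neg]⟩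
    have hirr := irreducible_X_pow_two_pow_sub_C ⟨i, hi⟩ hns (d + 1)
    have hmp : minpoly K y = X ^ 2 ^ (d + 1) - C c :=
      (minpoly.eq_of_irreducible_of_monic hirr (by simp [hc])
        (monic_X_pow_sub_C c (by positivity))).symm
    have hint : IsIntegral K y :=
      ⟨X ^ 2 ^ (d + 1) - C c, monic_X_pow_sub_C c (by positivity), by simp [hc]⟩
    have key := congrArg (Algebra.norm K) hz
    rw [map_pow, ← PowerBasis.ofAdjoinEqTop_gen hint hgen,
      Algebra.PowerBasis.norm_gen_eq_coeff_zero_minpoly] at key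
    have hev : Even (2 ^ (d + 1)) := (even_two).pow_of_ne_zero (Nat.succ_ne_zero d)
    simp [hmp, hev.neg_one_pow, (pow_ne_zero (d + 1) two_ne_zero).symm] at key
    exact hns (i * Algebra.norm K z) (by rw [mul_pow, hi, key]; ring)

open Polynomial in
theorem adjoinRoot_root_pow_eq_algebraMap {K : Type*} [Field K] (a : K) (m : ℕ) :
    AdjoinRoot.root (X ^ m - C a) ^ m = algebraMap K _ a := by
  have h := AdjoinRoot.eval₂_root (X ^ m - C a)
  rw [eval₂_sub, eval₂_X_pow, eval₂_C] at h
  exact sub_eq_zero.1 h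

section RootSquare

open Polynomial

variable {K : Type*} [Field K] (a : K) {m M : ℕ} (hM : M = m * 2)

/-- The map `K[X]/(X ^ m - a) → K[X]/(X ^ (2 * m) - a)` sending the root to the square of the
root. -/
def rootSquareHom : AdjoinRoot (X ^ m - C a) →ₐ[K] AdjoinRoot (X ^ M - C a) :=
  AdjoinRoot.liftAlgHom _ (Algebra.ofId K _) (AdjoinRoot.root (X ^ M - C a) ^ 2) (by
    rw [eval₂_sub, eval₂_X_pow, eval₂_C, ← pow_mul, mul_comm, ← hM,
      adjoinRoot_root_pow_eq_algebraMap]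
    exact sub_self _)

theorem rootSquareHom_root :
    rootSquareHom a hM (AdjoinRoot.root _) = AdjoinRoot.root (X ^ M - C a) ^ 2 :=
  AdjoinRoot.liftAlgHom_root ..

theorem rootSquareHom_mk (p : K[X]) :
    rootSquareHom a hM (AdjoinRoot.mk _ p) = AdjoinRoot.mk _ (expand K 2 p) := by
  rw [← AdjoinRoot.aeval_eq, ← AdjoinRoot.aeval_eq, ← aeval_algHom_apply, rootSquareHom_root,
    expand_aeval]

theorem rootSquareHom_injective : Function.Injective (rootSquareHom a hM) := by
  rw [injective_iff_map_eq_zero]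
  intro x
  induction x using AdjoinRoot.induction_on with
  | ih p =>
    rw [rootSquareHom_mk, AdjoinRoot.mk_eq_zero, AdjoinRoot.mk_eq_zero]
    rintro ⟨q, hq⟩
    have hexp : (X ^ M - C a : K[X]) = expand K 2 (X ^ m - C a) := by
      simp [hM, ← pow_mul, mul_comm]
    refine ⟨contract 2 q, ?_⟩
    have := congrArg (contract 2) hq
    rwa [contract_expand 2 two_ne_zero, hexp, mul_comm, contract_mul_expand two_ne_zero,
      mul_comm] at this

theorem exists_eq_rootSquareHom_add (e : AdjoinRoot (X ^ M - C a)) :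
    ∃ u v, e = rootSquareHom a hM u + AdjoinRoot.root _ * rootSquareHom a hM v := by
  induction e using AdjoinRoot.induction_on with
  | ih p =>
    induction p using Polynomial.induction_on' with
    | add p q hp hq =>
      obtain ⟨u, v, h⟩ := hp
      obtain ⟨u', v', h'⟩ := hq
      exact ⟨u + u', v + v', by rw [map_add, h, h', map_add, map_add]; ring⟩
    | monomial k c =>
      rcases Nat.even_or_odd' k with ⟨l, rfl | rfl⟩
      · refine ⟨AdjoinRoot.mk _ (monomial l c), 0, ?_⟩
        rw [rootSquareHom_mk, expand_monomial, map_zero, mul_zero, add_zero, mul_comm]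
      · refine ⟨0, AdjoinRoot.mk _ (monomial l c), ?_⟩
        rw [rootSquareHom_mk, expand_monomial, map_zero, zero_add, ← AdjoinRoot.mk_X, ← map_mul,
          X_mul_monomial, mul_comm]

/-- Substituting `-X` for `X` shows that the two coordinates of an idempotent satisfy the expected
equations. -/
theorem idempotent_coordinates (h2 : (2 : K) ≠ 0) (ha : a ≠ 0) (hm : m ≠ 0)
    {u v : AdjoinRoot (X ^ m - C a)}
    (he : IsIdempotentElem
      (rootSquareHom a hM u + AdjoinRoot.root (X ^ M - C a) * rootSquareHom a hM v)) :
    u ^ 2 + AdjoinRoot.root (X ^ m - C a) * v ^ 2 = u ∧ 2 * (u * v) = v := by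
  set x := AdjoinRoot.root (X ^ M - C a) with hx
  have hxM : x ^ M = algebraMap K _ a :=
    adjoinRoot_root_pow_eq_algebraMap a M
  let σ : AdjoinRoot (X ^ M - C a) →ₐ[K] AdjoinRoot (X ^ M - C a) :=
    AdjoinRoot.liftAlgHom _ (Algebra.ofId K _) (-x) (by
      rw [eval₂_sub, eval₂_X_pow, eval₂_C]
      rw [Even.neg_pow (by simp [hM]), hxM]
      exact sub_self _)
  have hσx : σ x = -x := AdjoinRoot.liftAlgHom_root ..
  have hσ : ∀ w, σ (rootSquareHom a hM w) = rootSquareHom a hM w := by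
    intro w
    have : σ.comp (rootSquareHom a hM) = rootSquareHom a hM := by
      apply AdjoinRoot.algHom_ext
      rw [AlgHom.comp_apply, rootSquareHom_root, map_pow, ← hx, hσx, neg_sq]
    exact DFunLike.congr_fun this w
  have he' := congrArg σ he.eq
  simp only [map_mul, map_add, hσ, hσx] at he'
  have he := he.eq
  have h2' : IsUnit (2 : AdjoinRoot (X ^ M - C a)) := by
    have := (IsUnit.mk0 _ h2).map (algebraMap K (AdjoinRoot (X ^ M - C a)))
    rwa [map_ofNat] at this
  have hxu : IsUnit x := by
    have : IsUnit (x ^ M) := hxM ▸ (IsUnit.mk0 _ ha).map _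
    exact (isUnit_pow_iff (by omega)).1 this
  constructor <;> apply rootSquareHom_injective a hM
  · apply h2'.mul_left_cancel
    simp only [map_mul, map_add, map_pow, rootSquareHom_root, ← hx]
    linear_combination he + he'
  · apply (h2'.mul hxu).mul_left_cancel
    simp only [map_mul, map_ofNat]
    linear_combination he - he'

end RootSquare

open Polynomial in
/-- If `a` is not a `2 ^ (N + 1)`-th power, then every idempotent of
`K[X]/(X ^ 2 ^ (N + 1) - a)` comes
from an idempotent of `K[X]/(X ^ 2 ^ N - a)`. -/
theorem idempotent_mem_range_rootSquareHom {K : Type*} [Field K] (h2 : (2 : K) ≠ 0)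
    (hi : ∃ i : K, i ^ 2 = -1) {a : K} (ha : a ≠ 0) {N : ℕ}
    (hpow : ∀ c : K, c ^ 2 ^ (N + 1) ≠ a) {e : AdjoinRoot (X ^ 2 ^ (N + 1) - C a)}
    (he : IsIdempotentElem e) :
    ∃ u, IsIdempotentElem u ∧ rootSquareHom a (pow_succ 2 N) u = e := by
  obtain ⟨u, v, rfl⟩ := exists_eq_rootSquareHom_add a (pow_succ 2 N) e
  obtain ⟨h₁, h₂⟩ := idempotent_coordinates a (pow_succ 2 N) h2 ha (by positivity) he
  suffices hv : v = 0 by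
    subst hv
    exact ⟨u, by rw [IsIdempotentElem, ← sq]; simpa using h₁, by simp⟩
  by_contra hv
  set y := AdjoinRoot.root (X ^ 2 ^ N - C a) with hy
  have hyN : y ^ 2 ^ N = algebraMap K _ a :=
    adjoinRoot_root_pow_eq_algebraMap a _
  have hp : v * (1 - 4 * y * v ^ 2) = 0 := by
    linear_combination (-4 * v) * h₁ + (2 * u - 1) * h₂
  have hnu : 1 - 4 * y * v ^ 2 ∈ nonunits _ := fun h ↦ hv ((h.mul_left_eq_zero).1 hp)
  obtain ⟨I, hI, hmem⟩ := exists_max_ideal_of_mem_nonunits hnu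
  let _ : Field (AdjoinRoot (X ^ 2 ^ N - C a) ⧸ I) := Ideal.Quotient.field I
  let π := Ideal.Quotient.mkₐ K I
  have h1 : π (1 - 4 * y * v ^ 2) = 0 := Ideal.Quotient.eq_zero_iff_mem.2 hmem
  simp only [map_sub, map_mul, map_one, map_pow, map_ofNat] at h1
  have hgen : Algebra.adjoin K {π y} = ⊤ := by
    rw [← Set.image_singleton, ← AlgHom.map_adjoin, AdjoinRoot.adjoinRoot_eq_top, Algebra.map_top,
      AlgHom.range_eq_top]
    exact Ideal.Quotient.mkₐ_surjective K I
  obtain ⟨c, hc⟩ := exists_pow_eq_of_isSquare_generator (L := AdjoinRoot (X ^ 2 ^ N - C a) ⧸ I)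
    hi (y := π y) (z := 2 * π y * π v) (N := N) (a := a)
    (by rw [← map_pow, hyN, AlgHom.commutes]) hgen (by linear_combination (-π y) * h1)
  exact hpow c hc

open Polynomial in
/-- If `a` is not a `2 ^ t`-th power for `N < t ≤ N + k`, then the idempotents of
`K[X]/(X ^ 2 ^ (N + k) - a)` are polynomials in the `2 ^ k`-th power of the root. -/
theorem idempotent_mem_adjoin_root_pow {K : Type*} [Field K] (h2 : (2 : K) ≠ 0)
    (hi : ∃ i : K, i ^ 2 = -1) {a : K} (ha : a ≠ 0) (N k : ℕ)
    (hpow : ∀ t, N < t → t ≤ N + k → ∀ c : K, c ^ 2 ^ t ≠ a)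
    (e : AdjoinRoot (X ^ 2 ^ (N + k) - C a)) (he : IsIdempotentElem e) :
    e ∈ Algebra.adjoin K {AdjoinRoot.root (X ^ 2 ^ (N + k) - C a) ^ 2 ^ k} := by
  induction k with
  | zero => simp [AdjoinRoot.adjoinRoot_eq_top]
  | succ k ih =>
    obtain ⟨u, hu, rfl⟩ := idempotent_mem_range_rootSquareHom h2 hi ha
      (hpow (N + k + 1) (by omega) (by omega)) he
    have := Subalgebra.mem_map.2 ⟨u, ih (fun t h h' ↦ hpow t h (by omega)) u hu,
      (rfl : rootSquareHom a (pow_succ 2 (N + k)) u = _)⟩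
    rwa [AlgHom.map_adjoin, Set.image_singleton, map_pow, rootSquareHom_root, ← pow_mul,
      ← pow_succ'] at this

/-- A subalgebra containing all idempotents has the same minimal idempotents. -/
theorem isMinIdem_iff_of_idempotents_mem {K A : Type*} [Field K] [CommRing A] [Algebra K A]
    (B : Subalgebra K A) (hB : ∀ e : A, e * e = e → e ∈ B) (e : A) :
    IsMinIdem e ↔ ∃ f : B, (f : A) = e ∧ IsMinIdem f := by
  constructor
  · rintro ⟨h0, hid, hmin⟩
    refine ⟨⟨e, hB e hid⟩, rfl, fun h ↦ h0 (congrArg Subtype.val h), Subtype.ext hid, ?_⟩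
    rintro ⟨e₁, e₂, h₁, h₂, h₃, h₄, h₅, h₆⟩
    exact hmin ⟨e₁, e₂, fun h ↦ h₁ (Subtype.ext h), fun h ↦ h₂ (Subtype.ext h),
      congrArg Subtype.val h₃, congrArg Subtype.val h₄, congrArg Subtype.val h₅,
      congrArg Subtype.val h₆⟩
  · rintro ⟨f, rfl, h0, hid, hmin⟩
    refine ⟨fun h ↦ h0 (Subtype.ext h), congrArg Subtype.val hid, ?_⟩
    rintro ⟨e₁, e₂, h₁, h₂, h₃, h₄, h₅, h₆⟩
    exact hmin ⟨⟨e₁, hB _ h₃⟩, ⟨e₂, hB _ h₄⟩, fun h ↦ h₁ (congrArg Subtype.val h),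
      fun h ↦ h₂ (congrArg Subtype.val h), Subtype.ext h₃, Subtype.ext h₄, Subtype.ext h₅,
      Subtype.ext h₆⟩

/-- Theorem 1, part 2): the minimal idempotents of `A = K[X]/(X^{2^n} - a)`
coincide with the minimal idempotents of the subalgebra `B` spanned by
`1, h, …, h^{2^s - 1}`, where `h = ḡ^{2^{n-s}}·b⁻¹`. -/
theorem stmt_12 (K : Type*) [Field K] (h2 : (2 : K) ≠ 0)
    (ε : ℕ → AlgebraicClosure K)
    (hprim : ∀ n : ℕ, IsPrimitiveRoot (ε n) (2 ^ n))
    (hcomp : ∀ n : ℕ, ε (n + 1) ^ 2 = ε n)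
    (hε2 : InK K (ε 2))
    (n : ℕ) (hn : 1 ≤ n) (a : K) (ha : a ≠ 0)
    -- `s = H_n(a)`:
    (s : ℕ) (hsn : s ≤ n) (hmem : MemKs K ε s a)
    (hmax : ∀ t : ℕ, t ≤ n → MemKs K ε t a → t ≤ s)
    (b : K) (hb : b ≠ 0) (hab : a = b ^ 2 ^ s)
    -- `ḡ` is the image of `X` in `A = K[X]/(X^{2^n} - a)`:
    (g : AdjoinRoot (Polynomial.X ^ 2 ^ n - Polynomial.C a))
    (hg : g = AdjoinRoot.root (Polynomial.X ^ 2 ^ n - Polynomial.C a))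
    (h : AdjoinRoot (Polynomial.X ^ 2 ^ n - Polynomial.C a))
    (hh : h = algebraMap K (AdjoinRoot (Polynomial.X ^ 2 ^ n - Polynomial.C a)) b⁻¹ *
      g ^ 2 ^ (n - s))
    -- `B` is the `K`-subalgebra spanned by `1, h, …, h^{2^s - 1}`:
    (B : Subalgebra K (AdjoinRoot (Polynomial.X ^ 2 ^ n - Polynomial.C a)))
    (hB : Subalgebra.toSubmodule B =
      Submodule.span K (Set.range fun i : Fin (2 ^ s) => h ^ (i : ℕ))) :
    ∀ e : AdjoinRoot (Polynomial.X ^ 2 ^ n - Polynomial.C a),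
      IsMinIdem e ↔ ∃ f : B, (f : AdjoinRoot (Polynomial.X ^ 2 ^ n - Polynomial.C a)) = e ∧
        IsMinIdem f := by
  have hi : ∃ i : K, i ^ 2 = -1 := by
    obtain ⟨i, hi⟩ := hε2
    refine ⟨i, (algebraMap K (AlgebraicClosure K)).injective ?_⟩
    have h1 : ε 1 = -1 := IsPrimitiveRoot.eq_neg_one_of_two_right (by simpa using hprim 1)
    rw [map_pow, hi, hcomp 1, h1, map_neg, map_one]
  have hpow : ∀ t, s < t → t ≤ n → ∀ c : K, c ^ 2 ^ t ≠ a := by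
    intro t hst htn c hc
    refine absurd (hmax t htn ⟨algebraMap K _ c, IntermediateField.algebraMap_mem _ c, ?_, ?_⟩)
      (not_le.2 hst)
    · rintro h0
      rw [map_eq_zero] at h0
      rw [h0, zero_pow (by positivity)] at hc
      exact ha hc.symm
    · rw [← map_pow, hc]
  obtain ⟨k, rfl⟩ := Nat.exists_eq_add_of_le hsn
  rw [Nat.add_sub_cancel_left] at hh
  refine isMinIdem_iff_of_idempotents_mem B fun e he ↦ ?_
  refine (Algebra.adjoin_le ?_ : _ ≤ B) (idempotent_mem_adjoin_root_pow h2 hi ha s k hpow e he)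
  rw [Set.singleton_subset_iff, ← hg, SetLike.mem_coe]
  rcases Nat.eq_zero_or_pos s with rfl | hs
  · have hgk : g ^ 2 ^ k = algebraMap K _ a := by
      simpa only [hg, zero_add] using adjoinRoot_root_pow_eq_algebraMap a (2 ^ (0 + k))
    rw [hgk]
    exact B.algebraMap_mem a
  · have hhB : h ∈ B := by
      rw [← Subalgebra.mem_toSubmodule, hB]
      exact Submodule.subset_span ⟨⟨1, Nat.one_lt_two_pow hs.ne'⟩, pow_one h⟩
    have hgh : g ^ 2 ^ k = algebraMap K _ b * h := by
      rw [hh, ← mul_assoc, ← map_mul, mul_inv_cancel₀ hb, map_one, one_mul]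
    rw [hgh]
    exact B.mul_mem (B.algebraMap_mem b) hhB
end
end
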